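/- arXiv:2410.00217 — 4 statements merged into one kernel-verified Lean document; each statement's English description precedes it below -/
import Mathlib

section
/- Let d be a positive integer, let σ : Fin d → ℝ with σ_i ≥ 0 for all i, and let a : Fin d → ℝ. Define s : Fin d → ℝ by s_i = 1 if a_i ≥ 0 and s_i = −1 if a_i < 0, and define the matrix ρ* by ρ*_ij = s_i s_j. Then ρ* is symmetric positive-semidefinite, has unit diagonal, has all entries in [−1,1], and attains the worst-case variance: ∑_{i,j} ρ*_ij σ_i σ_j a_i a_j = (∑_i σ_i |a_i|)². Consequently, the supremum of ∑_{i,j} ρ_ij σ_i σ_j a_i a_j over all symmetric positive-semidefinite real d×d matrices ρ with unit diagonal equals (∑_i σ_i |a_i|)². -/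
open Matrix

/-- The off-diagonal entries of a real positive semidefinite matrix with unit diagonal
have absolute value at most one. -/
theorem Matrix.PosSemidef.abs_apply_le_one {n : Type*} [Fintype n] {ρ : Matrix n n ℝ}
    (hρ : ρ.PosSemidef) (hdiag : ∀ i, ρ i i = 1) (i j : n) : |ρ i j| ≤ 1 := by
  classical
  have hsymm : ρ j i = ρ i j := by simpa using hρ.isHermitian.apply i j
  have hadd := hρ.dotProduct_mulVec_nonneg (Pi.single i 1 + Pi.single j 1)
  have hsub := hρ.dotProduct_mulVec_nonneg (Pi.single i 1 - Pi.single j 1)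
  simp [mulVec_add, add_dotProduct, hdiag, hsymm] at hadd
  simp [mulVec_sub, sub_dotProduct, hdiag, hsymm] at hsub
  rw [abs_le]
  constructor <;> linarith

/-- The quadratic form of a matrix with entries bounded by one is at most the squared
weighted `ℓ¹` norm. -/
theorem sum_mul_le_sq_sum_mul_abs {n : Type*} [Fintype n] {σ : n → ℝ} (hσ : ∀ i, 0 ≤ σ i)
    (a : n → ℝ) {ρ : Matrix n n ℝ} (hρ : ∀ i j, |ρ i j| ≤ 1) :
    ∑ i, ∑ j, ρ i j * σ i * σ j * a i * a j ≤ (∑ i, σ i * |a i|) ^ 2 := by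
  rw [sq, Finset.sum_mul_sum]
  refine Finset.sum_le_sum fun i _ => Finset.sum_le_sum fun j _ => ?_
  calc ρ i j * σ i * σ j * a i * a j
      ≤ |ρ i j * σ i * σ j * a i * a j| := le_abs_self _
    _ = |ρ i j| * ((σ i * |a i|) * (σ j * |a j|)) := by
      simp only [abs_mul, abs_of_nonneg (hσ _)]
      ring
    _ ≤ (σ i * |a i|) * (σ j * |a j|) :=
      mul_le_of_le_one_left
        (mul_nonneg (mul_nonneg (hσ i) (abs_nonneg _)) (mul_nonneg (hσ j) (abs_nonneg _)))
        (hρ i j)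

/-- The sign matrix `ρ*_ij = s_i s_j` is a correlation matrix attaining the worst-case
variance `(∑ i, σ i * |a i|)²`, so the supremum of the variance over all correlation
matrices equals the worst-case variance (SDP.1 / Equation (3.2) of the paper). -/
theorem worst_case_correlation_attained
    (d : ℕ) (hd : 0 < d) (σ a : Fin d → ℝ) (hσ : ∀ i, 0 ≤ σ i)
    (s : Fin d → ℝ) (hs : ∀ i, s i = if 0 ≤ a i then 1 else -1)
    (ρstar : Matrix (Fin d) (Fin d) ℝ) (hρstar : ∀ i j, ρstar i j = s i * s j) :
    ρstar.IsSymm ∧ ρstar.PosSemidef ∧ (∀ i, ρstar i i = 1) ∧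
      (∀ i j, ρstar i j ∈ Set.Icc (-1 : ℝ) 1) ∧
      (∑ i, ∑ j, ρstar i j * σ i * σ j * a i * a j = (∑ i, σ i * |a i|) ^ 2) ∧
      sSup {t : ℝ | ∃ ρ : Matrix (Fin d) (Fin d) ℝ, ρ.IsSymm ∧ ρ.PosSemidef ∧
          (∀ i, ρ i i = 1) ∧ t = ∑ i, ∑ j, ρ i j * σ i * σ j * a i * a j}
        = (∑ i, σ i * |a i|) ^ 2 := by
  have hsa : ∀ i, s i * a i = |a i| := by
    intro i
    rw [hs]
    split_ifs with h
    · rw [one_mul, abs_of_nonneg h]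
    · rw [neg_one_mul, abs_of_neg (not_le.mp h)]
  have hss : ∀ i, s i * s i = 1 := by
    intro i
    rw [hs]
    split_ifs <;> norm_num
  have hsymm : ρstar.IsSymm := by
    ext i j
    rw [transpose_apply, hρstar, hρstar, mul_comm]
  have hpsd : ρstar.PosSemidef := by
    have h : ρstar = vecMulVec s (star s) := by
      ext i j
      simp [hρstar, vecMulVec_apply]
    rw [h]
    exact posSemidef_vecMulVec_self_star s
  have hdiag : ∀ i, ρstar i i = 1 := fun i => (hρstar i i).trans (hss i)
  have hval : ∑ i, ∑ j, ρstar i j * σ i * σ j * a i * a j = (∑ i, σ i * |a i|) ^ 2 := by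
    rw [sq, Finset.sum_mul_sum]
    refine Finset.sum_congr rfl fun i _ => Finset.sum_congr rfl fun j _ => ?_
    rw [hρstar, ← hsa, ← hsa]
    ring
  refine ⟨hsymm, hpsd, hdiag, fun i j => abs_le.mp (hpsd.abs_apply_le_one hdiag i j), hval, ?_⟩
  refine IsGreatest.csSup_eq ⟨⟨ρstar, hsymm, hpsd, hdiag, hval.symm⟩, ?_⟩
  rintro t ⟨ρ, -, hρ, hρdiag, rfl⟩
  exact sum_mul_le_sq_sum_mul_abs hσ a (hρ.abs_apply_le_one hρdiag)
end

section
/- Let μ > k be real numbers, let c be a real number, and let 0 < τ₁ ≤ τ₂. For τ > 0 let X_τ be distributed as the Gaussian measure with mean μ and variance τ². Then P(X_{τ₂} ≥ k + c·τ₂) ≤ P(X_{τ₁} ≥ k + c·τ₁). That is, under the alternative μ > k, the power of the one-sided t-test with critical value c is antitone in the standard deviation τ: power is minimized when variance is maximized. -/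
open MeasureTheory ProbabilityTheory

/-- The upper tail of a Gaussian measure, standardized. -/
theorem gaussianReal_apply_Ici_eq_standard (m a : ℝ) {τ : ℝ} (hτ : 0 < τ) :
    gaussianReal m (τ ^ 2).toNNReal (Set.Ici a) =
      gaussianReal 0 1 (Set.Ici ((a - m) / τ)) := by
  have hmap : gaussianReal m (τ ^ 2).toNNReal =
      ((gaussianReal 0 1).map (τ * ·)).map (· + m) := by
    rw [gaussianReal_map_const_mul, gaussianReal_map_add_const, mul_zero, zero_add, mul_one,
      Real.toNNReal_of_nonneg (sq_nonneg τ)]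
  rw [hmap, Measure.map_map (by fun_prop) (by fun_prop),
    Measure.map_apply (by fun_prop) measurableSet_Ici]
  congr 1
  ext x
  simp only [Set.mem_preimage, Function.comp_apply, Set.mem_Ici, div_le_iff₀ hτ,
    sub_le_iff_le_add, mul_comm τ x]

/-- Under the alternative `m > k`, the power of the one-sided t-test with critical value `c`
is antitone in the standard deviation: power is minimized when variance is maximized. -/
theorem power_antitone_in_standard_deviation
    (m k c τ₁ τ₂ : ℝ) (hmk : k < m) (hτ₁ : 0 < τ₁) (hττ : τ₁ ≤ τ₂) :
    ((gaussianReal m ((τ₂ ^ 2).toNNReal)) {x | k + c * τ₂ ≤ x}).toReal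
      ≤ ((gaussianReal m ((τ₁ ^ 2).toNNReal)) {x | k + c * τ₁ ≤ x}).toReal := by
  have hτ₂ : 0 < τ₂ := hτ₁.trans_le hττ
  have hthreshold : ∀ τ : ℝ, 0 < τ → (k + c * τ - m) / τ = c - (m - k) / τ := by
    intro τ hτ
    field_simp
    ring
  change (gaussianReal m (τ₂ ^ 2).toNNReal (Set.Ici (k + c * τ₂))).toReal ≤
    (gaussianReal m (τ₁ ^ 2).toNNReal (Set.Ici (k + c * τ₁))).toReal
  rw [gaussianReal_apply_Ici_eq_standard m _ hτ₁, gaussianReal_apply_Ici_eq_standard m _ hτ₂,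
    hthreshold τ₁ hτ₁, hthreshold τ₂ hτ₂]
  refine ENNReal.toReal_mono (measure_ne_top _ _) (measure_mono (Set.Ici_subset_Ici.mpr ?_))
  exact sub_le_sub_left (div_le_div_of_nonneg_left (sub_nonneg.mpr hmk.le) hτ₁ hττ) c
end

section
/- Let (Ω, P) be a probability space and let X and Y be real random variables with a ≤ X ≤ b almost surely and c ≤ Y ≤ d almost surely, for real constants a ≤ b and c ≤ d. Then Cov(X, Y) ≤ min( (E[X] − a)·(d − E[Y]), (b − E[X])·(E[Y] − c) ). -/
open MeasureTheory

/-- Covariance bound for a random variable bounded below and another one bounded above. -/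
theorem integral_mul_sub_mul_integral_le_of_ae_le
    {Ω : Type*} [MeasurableSpace Ω] {μ : Measure Ω} [IsProbabilityMeasure μ]
    {X Y : Ω → ℝ} {a d : ℝ} (hX : Integrable X μ) (hY : Integrable Y μ)
    (hXY : Integrable (fun ω ↦ X ω * Y ω) μ)
    (ha : ∀ᵐ ω ∂μ, a ≤ X ω) (hd : ∀ᵐ ω ∂μ, Y ω ≤ d) :
    (∫ ω, X ω * Y ω ∂μ) - (∫ ω, X ω ∂μ) * (∫ ω, Y ω ∂μ)
      ≤ ((∫ ω, X ω ∂μ) - a) * (d - ∫ ω, Y ω ∂μ) := by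
  have hadd : Integrable (fun ω ↦ X ω * d + a * Y ω) μ := (hX.mul_const d).add (hY.const_mul a)
  have hle : ∫ ω, X ω * Y ω ∂μ ≤ ∫ ω, (X ω * d + a * Y ω - a * d) ∂μ := by
    refine integral_mono_ae hXY (hadd.sub (integrable_const _)) ?_
    filter_upwards [ha, hd] with ω hω hω'
    linarith [mul_nonneg (sub_nonneg.2 hω) (sub_nonneg.2 hω')]
  rw [integral_sub hadd (integrable_const _),
    integral_add (hX.mul_const d) (hY.const_mul a), integral_mul_const, integral_const_mul,
    integral_const, probReal_univ, one_smul] at hle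
  linarith

/-- Upper covariance bound of Hössjer and Sjölander (Remark 1 of the paper): for random
variables with `a ≤ X ≤ b` and `c ≤ Y ≤ d` almost surely,
`Cov(X,Y) ≤ min((E[X]−a)(d−E[Y]), (b−E[X])(E[Y]−c))`. -/
theorem covariance_upper_bound_of_bounded
    {Ω : Type*} [MeasurableSpace Ω] (μ : Measure Ω) [IsProbabilityMeasure μ]
    (X Y : Ω → ℝ) (a b c d : ℝ) (hab : a ≤ b) (hcd : c ≤ d)
    (hX : AEStronglyMeasurable X μ) (hY : AEStronglyMeasurable Y μ)
    (hXb : ∀ᵐ ω ∂μ, X ω ∈ Set.Icc a b) (hYb : ∀ᵐ ω ∂μ, Y ω ∈ Set.Icc c d) :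
    (∫ ω, X ω * Y ω ∂μ) - (∫ ω, X ω ∂μ) * (∫ ω, Y ω ∂μ)
      ≤ min (((∫ ω, X ω ∂μ) - a) * (d - ∫ ω, Y ω ∂μ))
          ((b - ∫ ω, X ω ∂μ) * ((∫ ω, Y ω ∂μ) - c)) := by
  have hXi : Integrable X μ := .of_mem_Icc a b hX.aemeasurable hXb
  have hYi : Integrable Y μ := .of_mem_Icc c d hY.aemeasurable hYb
  have hXY : Integrable (fun ω ↦ X ω * Y ω) μ :=
    (memLp_of_bounded hXb hX 2).integrable_mul (memLp_of_bounded hYb hY 2)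
  refine le_min ?_ ?_
  · exact integral_mul_sub_mul_integral_le_of_ae_le hXi hYi hXY
      (hXb.mono fun _ h ↦ h.1) (hYb.mono fun _ h ↦ h.2)
  · have hYX : Integrable (fun ω ↦ Y ω * X ω) μ := by simpa only [mul_comm] using hXY
    have h := integral_mul_sub_mul_integral_le_of_ae_le hYi hXi hYX
      (hYb.mono fun _ h ↦ h.1) (hXb.mono fun _ h ↦ h.2)
    simp_rw [mul_comm (Y _)] at h
    linarith
end

section
/- Let (Ω, P) be a probability space and let X and Y be real random variables with a ≤ X ≤ b almost surely and c ≤ Y ≤ d almost surely, for real constants a ≤ b and c ≤ d. Then Cov(X, Y) ≥ −min( (E[X] − a)·(E[Y] − c), (b − E[X])·(d − E[Y]) ). -/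
open MeasureTheory

/-- If `(X - r) * (Y - s)` is almost surely nonnegative, then the covariance of `X` and `Y` is at
least `-(E[X] - r) * (E[Y] - s)`. -/
theorem neg_mul_le_integral_mul_sub_of_ae_nonneg
    {Ω : Type*} [MeasurableSpace Ω] {μ : Measure Ω} [IsProbabilityMeasure μ] {X Y : Ω → ℝ}
    (r s : ℝ) (hX : Integrable X μ) (hY : Integrable Y μ)
    (hXY : Integrable (fun ω ↦ X ω * Y ω) μ) (h : ∀ᵐ ω ∂μ, 0 ≤ (X ω - r) * (Y ω - s)) :
    -(((∫ ω, X ω ∂μ) - r) * ((∫ ω, Y ω ∂μ) - s))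
      ≤ (∫ ω, X ω * Y ω ∂μ) - (∫ ω, X ω ∂μ) * (∫ ω, Y ω ∂μ) := by
  have expand : ∫ ω, (X ω - r) * (Y ω - s) ∂μ
      = (∫ ω, X ω * Y ω ∂μ) - s * (∫ ω, X ω ∂μ) - r * (∫ ω, Y ω ∂μ) + r * s := by
    calc ∫ ω, (X ω - r) * (Y ω - s) ∂μ
        = ∫ ω, (X ω * Y ω - s * X ω - r * Y ω + r * s) ∂μ := by
          congr with ω
          ring
      _ = _ := by
          rw [integral_add ((hXY.sub' (hX.const_mul s)).sub' (hY.const_mul r))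
              (integrable_const _),
            integral_sub (hXY.sub' (hX.const_mul s)) (hY.const_mul r),
            integral_sub hXY (hX.const_mul s)]
          simp [integral_const_mul]
  linarith [integral_nonneg_of_ae h]

/-- Lower covariance bound of Hössjer and Sjölander (Remark 1 of the paper): for random
variables with `a ≤ X ≤ b` and `c ≤ Y ≤ d` almost surely,
`Cov(X,Y) ≥ −min((E[X]−a)(E[Y]−c), (b−E[X])(d−E[Y]))`. -/
theorem covariance_lower_bound_of_bounded
    {Ω : Type*} [MeasurableSpace Ω] (μ : Measure Ω) [IsProbabilityMeasure μ]
    (X Y : Ω → ℝ) (a b c d : ℝ) (hab : a ≤ b) (hcd : c ≤ d)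
    (hX : AEStronglyMeasurable X μ) (hY : AEStronglyMeasurable Y μ)
    (hXb : ∀ᵐ ω ∂μ, X ω ∈ Set.Icc a b) (hYb : ∀ᵐ ω ∂μ, Y ω ∈ Set.Icc c d) :
    -min (((∫ ω, X ω ∂μ) - a) * ((∫ ω, Y ω ∂μ) - c))
        ((b - ∫ ω, X ω ∂μ) * (d - ∫ ω, Y ω ∂μ))
      ≤ (∫ ω, X ω * Y ω ∂μ) - (∫ ω, X ω ∂μ) * (∫ ω, Y ω ∂μ) := by
  have hX2 := memLp_of_bounded hXb hX 2
  have hY2 := memLp_of_bounded hYb hY 2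
  have hXi := hX2.integrable one_le_two
  have hYi := hY2.integrable one_le_two
  have hXY : Integrable (fun ω ↦ X ω * Y ω) μ := hX2.integrable_mul hY2
  have lower := neg_mul_le_integral_mul_sub_of_ae_nonneg a c hXi hYi hXY <| by
    filter_upwards [hXb, hYb] with ω hx hy
    exact mul_nonneg (sub_nonneg.2 hx.1) (sub_nonneg.2 hy.1)
  have upper := neg_mul_le_integral_mul_sub_of_ae_nonneg b d hXi hYi hXY <| by
    filter_upwards [hXb, hYb] with ω hx hy
    exact mul_nonneg_of_nonpos_of_nonpos (sub_nonpos.2 hx.2) (sub_nonpos.2 hy.2)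
  rw [neg_le]
  exact le_min (by linarith) (by linarith)
end
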